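/- Let α ∈ ℝ, α ≠ 0, and let k ∈ ℝ², k ≠ 0, with s := |k|. For N > 2s let J_N(s) := lim_{ε→0⁺} ∫_{‖ζ‖≤N} (‖ζ‖² + 2 s ζ₁ − iε)⁻¹ dζ (this limit exists), and for N > 1 with (α/(2π)) ln N ≠ 1 set ε(N) := α/(1 − (α/(2π)) ln N). Then lim_{N→∞} ε(N)/(1 + ε(N)·(2π)⁻²·J_N(s)) = α/(1 + (α/(4π))(πi − 2 ln|k|)). In particular the limit denominator 1 + (α/(4π))(πi − 2 ln|k|) is automatically nonzero for real α ≠ 0, since its imaginary part is α/4. -/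

import Mathlib

open MeasureTheory Real Filter Topology

lemma aux_poisson (w : ℂ) (hw : ‖w‖ < 1) :
    ∫ θ in (-π)..π, (1 + w ^ 2 - 2 * w * (Real.cos θ : ℂ))⁻¹ = 2 * π / (1 - w ^ 2) := by
  have hper : Function.Periodic (fun θ : ℝ => (1 + w ^ 2 - 2 * w * (Real.cos θ : ℂ))⁻¹) (2 * π) := by
    intro θ; simp
  have h1 := hper.intervalIntegral_add_eq (-π) 0
  have e1 : -π + 2 * π = π := by ring
  rw [e1, zero_add] at h1
  rw [h1]
  have hne : ∀ z : ℂ, ‖z‖ ≤ 1 → 1 - w * z ≠ 0 := by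
    intro z hz h
    have h2 : w * z = 1 := by linear_combination -h
    have h3 : ‖w‖ * ‖z‖ = 1 := by rw [← norm_mul, h2, norm_one]
    nlinarith [norm_nonneg w, norm_nonneg z]
  have hc := Complex.circleIntegral_sub_inv_smul_of_differentiable_on_off_countable
    (R := 1) (c := 0) (w := w) (f := fun z => (1 - w * z)⁻¹) (s := ∅) Set.countable_empty
    (by simpa using hw)
    (by
      apply ContinuousOn.inv₀ (by fun_prop)
      intro z hz; exact hne z (by simpa using hz))
    (by
      intro z hz
      apply DifferentiableAt.inv (by fun_prop)
      exact hne z (by have := hz.1; simp at this; exact this.le))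
  rw [circleIntegral] at hc
  have key : ∀ θ : ℝ, deriv (circleMap 0 1) θ • ((circleMap 0 1 θ - w)⁻¹ • (1 - w * circleMap 0 1 θ)⁻¹)
      = Complex.I * (1 + w ^ 2 - 2 * w * (Real.cos θ : ℂ))⁻¹ := by
    intro θ
    have hz : ‖circleMap 0 1 θ‖ = 1 := by simp
    rw [deriv_circleMap]
    have hcos : 2 * (Real.cos θ : ℂ) = circleMap 0 1 θ + (circleMap 0 1 θ)⁻¹ := by
      simp only [circleMap, Complex.ofReal_one, one_mul, zero_add, Complex.ofReal_cos,
        Complex.cos, ← Complex.exp_neg]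
      ring_nf
    set z := circleMap 0 1 θ with hzdef
    have hz0 : z ≠ 0 := by intro h; rw [h] at hz; simp at hz
    have hzw : z - w ≠ 0 := by
      intro h
      have : z = w := by linear_combination h
      rw [this] at hz; linarith
    have hwz := hne z hz.le
    have e : 1 + w ^ 2 - 2 * w * (Real.cos θ : ℂ) = (1 - w * z) * (z - w) / z := by
      have : 1 + w ^ 2 - 2 * w * (Real.cos θ : ℂ) = 1 + w ^ 2 - w * (z + z⁻¹) := by
        rw [← hcos]; ring
      rw [this]; field_simp; ring
    rw [e]
    simp only [smul_eq_mul]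
    field_simp
  simp_rw [key] at hc
  rw [intervalIntegral.integral_const_mul] at hc
  have hI := Complex.I_ne_zero
  apply mul_left_cancel₀ hI
  rw [hc, smul_eq_mul]; simp only [div_eq_mul_inv]; ring

lemma aux_ang (a P Q : ℂ) (b : ℝ) (hb : 0 < b) (hP : P ^ 2 = Complex.I * (a - b))
    (hQ : Q ^ 2 = Complex.I * (a + b)) (hP1 : |P.im| < P.re) (hQ1 : |Q.im| < Q.re) :
    ∫ θ in (-π)..π, (a + b * (Real.cos θ : ℂ))⁻¹ = 2 * π * Complex.I / (P * Q) := by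
  have hI := Complex.I_sq
  have hQP : Q + P ≠ 0 := by
    intro h
    have := congrArg Complex.re h
    simp at this
    linarith [abs_nonneg P.im, abs_nonneg Q.im]
  have hP0 : P ≠ 0 := by
    intro h; rw [h] at hP1; simp at hP1
  have hQ0 : Q ≠ 0 := by
    intro h; rw [h] at hQ1; simp at hQ1
  have hb0 : (b : ℂ) ≠ 0 := by exact_mod_cast hb.ne'
  have hprod : (Q - P) * (Q + P) = 2 * Complex.I * b := by linear_combination hQ - hP
  have hQmP : Q - P ≠ 0 := by
    intro h; rw [h, zero_mul] at hprod
    exact mul_ne_zero (mul_ne_zero two_ne_zero Complex.I_ne_zero) hb0 hprod.symm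
  set w : ℂ := -(Q - P) / (Q + P) with hwdef
  have hw : ‖w‖ < 1 := by
    rw [hwdef, norm_div, norm_neg, div_lt_one (norm_pos_iff.mpr hQP)]
    rw [← sq_lt_sq₀ (norm_nonneg _) (norm_nonneg _), Complex.sq_norm, Complex.sq_norm,
      Complex.normSq_apply, Complex.normSq_apply]
    simp only [Complex.sub_re, Complex.sub_im, Complex.add_re, Complex.add_im]
    obtain ⟨h1, h2⟩ := abs_lt.mp hP1
    obtain ⟨h3, h4⟩ := abs_lt.mp hQ1
    nlinarith [mul_pos (sub_pos.mpr h2) (sub_pos.mpr h4),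
      mul_pos (sub_pos.mpr h1) (sub_pos.mpr h3), mul_pos (sub_pos.mpr h2) (sub_pos.mpr h3),
      mul_pos (sub_pos.mpr h1) (sub_pos.mpr h4)]
  have hwQ : w * (Q + P) = -(Q - P) := by rw [hwdef]; field_simp
  have hw0 : w ≠ 0 := by
    rw [hwdef]; exact div_ne_zero (neg_ne_zero.mpr hQmP) hQP
  have haw : 2 * a * w = -b * (1 + w ^ 2) := by
    have h2 : (Q + P) ^ 2 * (2 * a * w + b * (1 + w ^ 2)) = 0 := by
      have e : (Q + P) ^ 2 * (2 * a * w + b * (1 + w ^ 2))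
        = 2 * a * (Q + P) * (w * (Q + P)) + b * ((Q + P) ^ 2 + (w * (Q + P)) ^ 2) := by ring
      rw [e, hwQ]
      linear_combination (-2 * a) * hprod + 2 * b * hQ + 2 * b * hP
    have := (mul_eq_zero.mp h2).resolve_left (pow_ne_zero 2 hQP)
    linear_combination this
  have hpt : ∀ θ : ℝ, (a + b * (Real.cos θ : ℂ))⁻¹ =
      (-(2 * w / b)) * (1 + w ^ 2 - 2 * w * (Real.cos θ : ℂ))⁻¹ := by
    intro θ
    have : a + b * (Real.cos θ : ℂ) = (-(2 * w / b))⁻¹ * (1 + w ^ 2 - 2 * w * (Real.cos θ : ℂ)) := by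
      field_simp
      linear_combination haw
    rw [this, mul_inv, inv_inv]
  simp_rw [hpt]
  rw [intervalIntegral.integral_const_mul, aux_poisson w hw]
  have h1w : (Q + P) ^ 2 * (1 - w ^ 2) = 4 * (P * Q) := by
    have e : (Q + P) ^ 2 * (1 - w ^ 2) = (Q + P) ^ 2 - (w * (Q + P)) ^ 2 := by ring
    rw [e, hwQ]; ring
  have h1w0 : 1 - w ^ 2 ≠ 0 := by
    intro h; rw [h, mul_zero] at h1w
    exact mul_ne_zero (by norm_num : (4 : ℂ) ≠ 0) (mul_ne_zero hP0 hQ0) h1w.symm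
  have hfin : -(2 * w) * (P * Q) = Complex.I * b * (1 - w ^ 2) := by
    apply mul_left_cancel₀ (pow_ne_zero 2 hQP)
    have e : (Q + P) ^ 2 * (-(2 * w) * (P * Q)) = -2 * (Q + P) * (w * (Q + P)) * (P * Q) := by ring
    have e2 : (Q + P) ^ 2 * (Complex.I * b * (1 - w ^ 2)) = Complex.I * b * ((Q + P) ^ 2 * (1 - w ^ 2)) := by ring
    rw [e, e2, hwQ, h1w]
    linear_combination 2 * (P * Q) * hprod
  rw [eq_div_iff (mul_ne_zero hP0 hQ0)]
  field_simp
  linear_combination hfin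

noncomputable def csq (z : ℂ) : ℂ := z ^ ((2 : ℂ)⁻¹)

lemma csq_sq (z : ℂ) : csq z ^ 2 = z := Complex.cpow_ofNat_inv_pow z 2

lemma csq_re (z : ℂ) (hz : z ≠ 0) (h : z.arg ≠ π) : 0 < (csq z).re := by
  have h1 := Complex.neg_pi_lt_arg z
  have h2 := lt_of_le_of_ne (Complex.arg_le_pi z) h
  rw [csq, Complex.cpow_def_of_ne_zero hz, Complex.exp_re]
  apply mul_pos (Real.exp_pos _)
  have : (Complex.log z * (2 : ℂ)⁻¹).im = z.arg / 2 := by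
    have : (2 : ℂ)⁻¹ = ((2⁻¹ : ℝ) : ℂ) := by push_cast; rfl
    rw [this, Complex.im_mul_ofReal, Complex.log_im]; ring
  rw [this]
  apply Real.cos_pos_of_mem_Ioo
  constructor <;> linarith

lemma csq_re' (z : ℂ) (hz : z ∈ Complex.slitPlane) : 0 < (csq z).re :=
  csq_re z (Complex.slitPlane_ne_zero hz) (Complex.mem_slitPlane_iff_arg.mp hz).1

lemma csq_im (z : ℂ) (hz : 0 < z.re) : |(csq z).im| < (csq z).re := by
  have h1 := csq_re' z (Or.inl hz)
  have h2 := congrArg Complex.re (csq_sq z)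
  rw [sq, Complex.mul_re] at h2
  apply abs_lt_of_sq_lt_sq _ h1.le
  nlinarith

lemma csq_pos (x : ℝ) (hx : 0 < x) : csq (Complex.I * x) = √(x / 2) * (1 + Complex.I) := by
  have h1 := csq_re' (Complex.I * x) (Or.inr (by simp [hx.ne']))
  have h2 := csq_sq (Complex.I * x)
  have hre := congrArg Complex.re h2
  have him := congrArg Complex.im h2
  simp [sq] at hre him
  have e : (csq (Complex.I * x)).im = (csq (Complex.I * x)).re := by
    rcases mul_self_eq_mul_self_iff.mp (sub_eq_zero.mp hre) with h | h
    · exact h.symm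
    · nlinarith
  have e2 : (csq (Complex.I * x)).re = √(x / 2) := by
    symm; rw [Real.sqrt_eq_iff_mul_self_eq (by positivity) h1.le]
    rw [e] at him; linarith
  apply Complex.ext <;> simp [e, e2]

lemma csq_neg (x : ℝ) (hx : x < 0) : csq (Complex.I * x) = √(-x / 2) * (1 - Complex.I) := by
  have h1 := csq_re' (Complex.I * x) (Or.inr (by simp [hx.ne]))
  have h2 := csq_sq (Complex.I * x)
  have hre := congrArg Complex.re h2
  have him := congrArg Complex.im h2
  simp [sq] at hre him
  have e : (csq (Complex.I * x)).im = -(csq (Complex.I * x)).re := by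
    rcases mul_self_eq_mul_self_iff.mp (sub_eq_zero.mp hre) with h | h
    · nlinarith
    · linarith
  have e2 : (csq (Complex.I * x)).re = √(-x / 2) := by
    symm; rw [Real.sqrt_eq_iff_mul_self_eq (by linarith) h1.le]
    rw [e] at him; linarith
  apply Complex.ext <;> simp [e, e2]

lemma csq_norm (z : ℂ) : ‖csq z‖ = √‖z‖ := by
  rw [eq_comm, Real.sqrt_eq_iff_eq_sq (norm_nonneg _) (norm_nonneg _), ← norm_pow, csq_sq]

lemma csq_meas : Measurable csq := by unfold csq; fun_prop

lemma csq_cont (z : ℂ) (hz : z ∈ Complex.slitPlane) : ContinuousAt csq z := by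
  unfold csq; exact continuousAt_id.cpow continuousAt_const hz

lemma ker_left (c : ℝ) (hc : 0 < c) :
    IntervalIntegrable (fun r : ℝ => (√|r ^ 2 - c ^ 2|)⁻¹) volume 0 c ∧
    ∫ r in (0 : ℝ)..c, (√|r ^ 2 - c ^ 2|)⁻¹ = π / 2 := by
  have hcont : ContinuousOn (fun r : ℝ => Real.arcsin (r / c)) (Set.Icc 0 c) :=
    (Real.continuous_arcsin.comp (by fun_prop)).continuousOn
  have hder : ∀ x ∈ Set.Ioo 0 c,
      HasDerivAt (fun r : ℝ => Real.arcsin (r / c)) ((√|x ^ 2 - c ^ 2|)⁻¹) x := by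
    intro x hx
    have h1 : x / c < 1 := (div_lt_one hc).mpr hx.2
    have h0 : 0 < x / c := div_pos hx.1 hc
    have := (Real.hasDerivAt_arcsin (x := x / c) (by linarith) (by linarith)).comp x
      ((hasDerivAt_id x).div_const c)
    refine this.congr_deriv ?_
    have e : |x ^ 2 - c ^ 2| = (1 - (x / c) ^ 2) * c ^ 2 := by
      rw [abs_of_neg (by nlinarith [hx.1, hx.2])]; field_simp; ring
    rw [e, Real.sqrt_mul' _ (sq_nonneg c), Real.sqrt_sq hc.le]
    simp [mul_comm]
  have hint : IntervalIntegrable (fun r : ℝ => (√|r ^ 2 - c ^ 2|)⁻¹) volume 0 c := by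
    rw [intervalIntegrable_iff_integrableOn_Ioc_of_le hc.le]
    exact intervalIntegral.integrableOn_deriv_of_nonneg hcont hder (fun x _ => by positivity)
  refine ⟨hint, ?_⟩
  rw [intervalIntegral.integral_eq_sub_of_hasDerivAt_of_le hc.le hcont hder hint]
  simp [div_self hc.ne']

lemma ker_right (c N : ℝ) (hc : 0 < c) (hN : c < N) :
    IntervalIntegrable (fun r : ℝ => (√|r ^ 2 - c ^ 2|)⁻¹) volume c N ∧
    ∫ r in c..N, (√|r ^ 2 - c ^ 2|)⁻¹ = Real.arcosh (N / c) := by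
  have hcont : ContinuousOn (fun r : ℝ => Real.arcosh (r / c)) (Set.Icc c N) := by
    apply Real.continuousOn_arcosh.comp (by fun_prop)
    intro x hx
    exact (one_le_div hc).mpr hx.1
  have hder : ∀ x ∈ Set.Ioo c N,
      HasDerivAt (fun r : ℝ => Real.arcosh (r / c)) ((√|x ^ 2 - c ^ 2|)⁻¹) x := by
    intro x hx
    have h1 : 1 < x / c := (one_lt_div hc).mpr hx.1
    have := (Real.hasDerivAt_arcosh (x := x / c) h1).comp x
      ((hasDerivAt_id x).div_const c)
    refine this.congr_deriv ?_
    have e : |x ^ 2 - c ^ 2| = ((x / c) ^ 2 - 1) * c ^ 2 := by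
      rw [abs_of_pos (by nlinarith [hx.1, hx.2])]; field_simp
    rw [e, Real.sqrt_mul' _ (sq_nonneg c), Real.sqrt_sq hc.le]
    simp [mul_comm]
  have hint : IntervalIntegrable (fun r : ℝ => (√|r ^ 2 - c ^ 2|)⁻¹) volume c N := by
    rw [intervalIntegrable_iff_integrableOn_Ioc_of_le hN.le]
    exact intervalIntegral.integrableOn_deriv_of_nonneg hcont hder (fun x _ => by positivity)
  refine ⟨hint, ?_⟩
  rw [intervalIntegral.integral_eq_sub_of_hasDerivAt_of_le hN.le hcont hder hint]
  simp [div_self hc.ne']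

noncomputable def radF (c ε r : ℝ) : ℂ :=
  (r : ℂ) * (2 * π * Complex.I / (csq (ε + Complex.I * ((r ^ 2 - c * r : ℝ) : ℂ)) *
    csq (ε + Complex.I * ((r ^ 2 + c * r : ℝ) : ℂ))))

lemma radF_meas (c ε : ℝ) : Measurable (radF c ε) := by
  unfold radF
  apply Measurable.mul (by fun_prop)
  apply Measurable.div (by fun_prop)
  apply Measurable.mul
  · exact csq_meas.comp (by fun_prop)
  · exact csq_meas.comp (by fun_prop)

lemma abs_xy (c r : ℝ) (hr : 0 < r) : √|r ^ 2 - c * r| * √|r ^ 2 + c * r| = r * √|r ^ 2 - c ^ 2| := by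
  rw [← Real.sqrt_mul (abs_nonneg _), ← abs_mul]
  have : (r ^ 2 - c * r) * (r ^ 2 + c * r) = r ^ 2 * (r ^ 2 - c ^ 2) := by ring
  rw [this, abs_mul, abs_of_pos (by positivity : 0 < r ^ 2), Real.sqrt_mul (sq_nonneg r),
    Real.sqrt_sq hr.le]

lemma radF_bound (c ε r : ℝ) (hc : 0 < c) (hr : 0 < r) (hrc : r ≠ c) :
    ‖radF c ε r‖ ≤ 2 * π * (√|r ^ 2 - c ^ 2|)⁻¹ := by
  have hn : ∀ x : ℝ, √|x| ≤ ‖csq (ε + Complex.I * (x : ℂ))‖ := by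
    intro x
    rw [csq_norm]
    apply Real.sqrt_le_sqrt
    have := Complex.abs_im_le_norm (ε + Complex.I * (x : ℂ))
    simpa using this
  have h0 : 0 < √|r ^ 2 - c ^ 2| := by
    apply Real.sqrt_pos.mpr; apply abs_pos.mpr
    have : r ^ 2 - c ^ 2 = (r - c) * (r + c) := by ring
    rw [this]
    exact mul_ne_zero (sub_ne_zero.mpr hrc) (by positivity)
  have h1 := mul_le_mul (hn (r ^ 2 - c * r)) (hn (r ^ 2 + c * r)) (Real.sqrt_nonneg _) (norm_nonneg _)
  rw [abs_xy c r hr] at h1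
  unfold radF
  rw [norm_mul, norm_div, norm_mul (csq _)]
  have e1 : ‖(2 * π * Complex.I : ℂ)‖ = 2 * π := by simp [abs_of_pos Real.pi_pos]
  have e2 : ‖(r : ℂ)‖ = r := by simp [abs_of_pos hr]
  rw [e1, e2]
  calc r * (2 * π / _) ≤ r * (2 * π / (r * √|r ^ 2 - c ^ 2|)) := by
        gcongr
    _ = _ := by field_simp

noncomputable def limF (c r : ℝ) : ℂ :=
  (if r < c then 2 * π * Complex.I else 2 * π) * (((√|r ^ 2 - c ^ 2|)⁻¹ : ℝ) : ℂ)

lemma radF_lim (c r : ℝ) (hc : 0 < c) (hr : 0 < r) (hrc : r ≠ c) :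
    Tendsto (fun ε => radF c ε r) (𝓝[>] 0) (𝓝 (limF c r)) := by
  have hx : ∀ x : ℝ, x ≠ 0 → Tendsto (fun ε : ℝ => csq (ε + Complex.I * (x : ℂ))) (𝓝[>] 0)
      (𝓝 (csq (Complex.I * x))) := by
    intro x hx
    have h1 := csq_cont (Complex.I * x) (Or.inr (by simpa using hx))
    apply h1.tendsto.comp
    apply tendsto_nhdsWithin_of_tendsto_nhds
    have : Continuous (fun ε : ℝ => (ε : ℂ) + Complex.I * (x : ℂ)) := by fun_prop
    have := this.tendsto 0
    simpa using this
  have hx0 : r ^ 2 - c * r ≠ 0 := by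
    have : r ^ 2 - c * r = r * (r - c) := by ring
    rw [this]; exact mul_ne_zero hr.ne' (sub_ne_zero.mpr hrc)
  have hy0 : 0 < r ^ 2 + c * r := by positivity
  have hk : 0 < √|r ^ 2 - c ^ 2| := by
    apply Real.sqrt_pos.mpr; apply abs_pos.mpr
    have : r ^ 2 - c ^ 2 = (r - c) * (r + c) := by ring
    rw [this]
    exact mul_ne_zero (sub_ne_zero.mpr hrc) (by positivity)
  have hprod : csq (Complex.I * ((r ^ 2 - c * r : ℝ) : ℂ)) * csq (Complex.I * ((r ^ 2 + c * r : ℝ) : ℂ))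
      = (if r < c then 1 else Complex.I) * ((r * √|r ^ 2 - c ^ 2| : ℝ) : ℂ) := by
    rw [csq_pos _ hy0, ← abs_xy c r hr, abs_of_pos hy0]
    have h2 : (√2 : ℂ) * √2 = 2 := by
      rw [← Complex.ofReal_mul, Real.mul_self_sqrt (by norm_num)]; norm_num
    have h20 : (√2 : ℂ) ≠ 0 := by
      intro h; rw [h] at h2; norm_num at h2
    split_ifs with h
    · have hneg : r ^ 2 - c * r < 0 := by nlinarith
      rw [csq_neg _ hneg, abs_of_neg hneg, Real.sqrt_div (by linarith), Real.sqrt_div hy0.le]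
      generalize √(-(r ^ 2 - c * r)) = A
      generalize √(r ^ 2 + c * r) = B
      push_cast
      field_simp
      linear_combination (-(A : ℂ) * B) * Complex.I_sq - (A : ℂ) * B * h2
    · have hpos : 0 < r ^ 2 - c * r := by
        have : c < r := lt_of_le_of_ne (not_lt.mp h) hrc.symm
        nlinarith
      rw [csq_pos _ hpos, abs_of_pos hpos, Real.sqrt_div (by linarith), Real.sqrt_div hy0.le]
      generalize √(r ^ 2 - c * r) = A
      generalize √(r ^ 2 + c * r) = B
      push_cast
      field_simp
      linear_combination ((A : ℂ) * B) * Complex.I_sq - Complex.I * (A : ℂ) * B * h2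
  have hkC : ((√|r ^ 2 - c ^ 2| : ℝ) : ℂ) ≠ 0 := by exact_mod_cast hk.ne'
  have hrC : (r : ℂ) ≠ 0 := by exact_mod_cast hr.ne'
  have hlim : limF c r = (r : ℂ) * (2 * π * Complex.I / (csq (Complex.I * ((r ^ 2 - c * r : ℝ) : ℂ)) *
    csq (Complex.I * ((r ^ 2 + c * r : ℝ) : ℂ)))) := by
    rw [hprod, limF]
    have hI := Complex.I_ne_zero
    push_cast
    split_ifs
    · field_simp
    · field_simp
  rw [hlim]
  unfold radF
  apply Tendsto.const_mul
  apply Tendsto.div tendsto_const_nhds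
  · exact (hx _ hx0).mul (hx _ hy0.ne')
  · rw [hprod]
    apply mul_ne_zero
    · split_ifs
      · exact one_ne_zero
      · exact Complex.I_ne_zero
    · exact_mod_cast (mul_pos hr hk).ne'

lemma limF_int (c N : ℝ) (hc : 0 < c) (hN : c < N) :
    ∫ r in (0 : ℝ)..N, limF c r = 2 * π * Real.arcosh (N / c) + Complex.I * π ^ 2 := by
  obtain ⟨i1, e1⟩ := ker_left c hc
  obtain ⟨i2, e2⟩ := ker_right c N hc hN
  have c1 : ∀ᵐ r : ℝ, r ∈ Set.uIoc 0 c → limF c r = 2 * π * Complex.I * (((√|r ^ 2 - c ^ 2|)⁻¹ : ℝ) : ℂ) := by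
    have : ∀ᵐ r : ℝ, r ≠ c := by simp [ae_iff, measure_singleton]
    filter_upwards [this] with r hr h
    rw [Set.uIoc_of_le hc.le] at h
    rw [limF, if_pos (lt_of_le_of_ne h.2 hr)]
  have c2 : ∀ᵐ r : ℝ, r ∈ Set.uIoc c N → limF c r = 2 * π * (((√|r ^ 2 - c ^ 2|)⁻¹ : ℝ) : ℂ) := by
    refine Eventually.of_forall fun r h => ?_
    rw [Set.uIoc_of_le hN.le] at h
    rw [limF, if_neg (not_lt.mpr h.1.le)]
  have j1 : IntervalIntegrable (limF c) volume 0 c := by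
    refine IntervalIntegrable.congr_ae ?_ ((ae_restrict_iff' measurableSet_uIoc).mpr (c1.mono fun r h h' => (h h').symm))
    exact IntervalIntegrable.const_mul ⟨i1.1.ofReal, i1.2.ofReal⟩ _
  have j2 : IntervalIntegrable (limF c) volume c N := by
    refine IntervalIntegrable.congr_ae ?_ ((ae_restrict_iff' measurableSet_uIoc).mpr (c2.mono fun r h h' => (h h').symm))
    exact IntervalIntegrable.const_mul ⟨i2.1.ofReal, i2.2.ofReal⟩ _
  rw [← intervalIntegral.integral_add_adjacent_intervals j1 j2,
    intervalIntegral.integral_congr_ae c1, intervalIntegral.integral_congr_ae c2,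
    intervalIntegral.integral_const_mul, intervalIntegral.integral_const_mul,
    intervalIntegral.integral_ofReal, intervalIntegral.integral_ofReal, e1, e2]
  push_cast; ring

lemma rad_tendsto (c N : ℝ) (hc : 0 < c) (hN : c < N) :
    Tendsto (fun ε => ∫ r in (0 : ℝ)..N, radF c ε r) (𝓝[>] 0)
      (𝓝 (2 * π * Real.arcosh (N / c) + Complex.I * π ^ 2)) := by
  rw [← limF_int c N hc hN]
  have hne : ∀ᵐ r : ℝ, r ≠ c := by simp [ae_iff, measure_singleton]
  apply intervalIntegral.tendsto_integral_filter_of_dominated_convergence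
    (fun r => 2 * π * (√|r ^ 2 - c ^ 2|)⁻¹)
  · exact Eventually.of_forall fun ε => (radF_meas c ε).aestronglyMeasurable
  · refine Eventually.of_forall fun ε => ?_
    filter_upwards [hne] with r hr h
    rw [Set.uIoc_of_le (hc.trans hN).le] at h
    exact radF_bound c ε r hc h.1 hr
  · exact ((ker_left c hc).1.trans (ker_right c N hc hN).1).const_mul _
  · filter_upwards [hne] with r hr h
    rw [Set.uIoc_of_le (hc.trans hN).le] at h
    exact radF_lim c r hc h.1 hr

lemma polar_eq (s N ε : ℝ) (hs : 0 < s) (hN : 0 < N) (hε : 0 < ε) :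
    ∫ ζ in Metric.closedBall (0 : EuclideanSpace ℝ (Fin 2)) N,
      (((‖ζ‖ ^ 2 + 2 * s * ζ 0 : ℝ) : ℂ) - Complex.I * (ε : ℂ))⁻¹
    = ∫ r in (0 : ℝ)..N, radF (2 * s) ε r := by
  have hne : ∀ x : ℝ, (x : ℂ) - Complex.I * ε ≠ 0 := by
    intro x h
    have := congrArg Complex.im h
    simp at this
    exact hε.ne' this
  set e := Complex.orthonormalBasisOneI.repr with he
  have hmp : MeasurePreserving e := Complex.orthonormalBasisOneI.measurePreserving_repr
  rw [← hmp.setIntegral_preimage_emb e.toHomeomorph.measurableEmbedding]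
  have hpre : e ⁻¹' (Metric.closedBall 0 N) = Metric.closedBall (0 : ℂ) N := by
    ext z; simp
  have h0 : ∀ z : ℂ, (e z) 0 = z.re := by
    intro z; simp [he]
  rw [hpre, ← integral_indicator Metric.isClosed_closedBall.measurableSet,
    ← Complex.integral_comp_polarCoord_symm]
  simp only [LinearIsometryEquiv.norm_map, h0]
  set G : ℝ × ℝ → ℂ := fun p => (p.1 : ℂ) * (((p.1 ^ 2 : ℝ) - Complex.I * ε : ℂ) + ((2 * s * p.1 : ℝ) : ℂ) * (Real.cos p.2 : ℂ))⁻¹ with hG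
  have hcG : Continuous G := by
    apply Continuous.mul (by fun_prop)
    apply Continuous.inv₀ (by fun_prop)
    intro p
    have := hne (p.1 ^ 2 + 2 * s * p.1 * Real.cos p.2)
    intro h; apply this; rw [← h]; push_cast; ring
  have step : ∫ p in polarCoord.target, p.1 • (Metric.closedBall (0 : ℂ) N).indicator
      (fun z => (((‖z‖ ^ 2 + 2 * s * z.re : ℝ) : ℂ) - Complex.I * (ε : ℂ))⁻¹) (Complex.polarCoord.symm p)
      = ∫ p in Set.Ioc 0 N ×ˢ Set.Ioo (-π) π, G p := by
    have hm : MeasurableSet (Set.Ioc (0 : ℝ) N ×ˢ Set.Ioo (-π) π) :=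
      measurableSet_Ioc.prod measurableSet_Ioo
    rw [← integral_indicator (polarCoord.open_target.measurableSet), ← integral_indicator hm]
    congr 1
    ext1 p
    by_cases hp : p ∈ polarCoord.target
    · rw [Set.indicator_of_mem hp]
      have hp' : 0 < p.1 ∧ p.2 ∈ Set.Ioo (-π) π := by simpa [polarCoord_target] using hp
      by_cases hpN : p.1 ≤ N
      · rw [Set.indicator_of_mem, Set.indicator_of_mem]
        · rw [Complex.norm_polarCoord_symm, sq_abs, hG]
          simp only [Complex.real_smul]
          congr 2
          simp [Complex.polarCoord_symm_apply]
          ring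
        · exact ⟨⟨hp'.1, hpN⟩, hp'.2⟩
        · rw [mem_closedBall_zero_iff, Complex.norm_polarCoord_symm, abs_of_pos hp'.1]; exact hpN
      · rw [Set.indicator_of_notMem, Set.indicator_of_notMem, smul_zero]
        · intro h; exact hpN h.1.2
        · rw [mem_closedBall_zero_iff, Complex.norm_polarCoord_symm, abs_of_pos hp'.1]; exact hpN
    · rw [Set.indicator_of_notMem hp, Set.indicator_of_notMem]
      intro h; apply hp
      rw [polarCoord_target]
      exact ⟨h.1.1, h.2⟩
  have step' := step
  refine step'.trans ?_
  have hint : IntegrableOn G (Set.Ioc 0 N ×ˢ Set.Ioo (-π) π) (volume.prod volume) := by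
    have := hcG.continuousOn.integrableOn_compact (μ := (volume : Measure (ℝ × ℝ)))
      (isCompact_Icc.prod isCompact_Icc : IsCompact (Set.Icc (0 : ℝ) N ×ˢ Set.Icc (-π) π))
    exact this.mono_set (Set.prod_mono Set.Ioc_subset_Icc_self Set.Ioo_subset_Icc_self)
  rw [Measure.volume_eq_prod, setIntegral_prod _ hint, intervalIntegral.integral_of_le hN.le]
  apply setIntegral_congr_fun measurableSet_Ioc
  intro r hr
  simp only [hG]
  rw [← integral_Ioc_eq_integral_Ioo, ← intervalIntegral.integral_of_le (by linarith [Real.pi_pos]),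
    intervalIntegral.integral_const_mul]
  unfold radF
  congr 1
  have hI := Complex.I_sq
  apply aux_ang _ _ _ _ (by have := hr.1; positivity)
  · rw [csq_sq]; push_cast; linear_combination ε * hI
  · rw [csq_sq]; push_cast; linear_combination ε * hI
  · apply csq_im; rw [Complex.add_re, Complex.re_mul_ofReal]; simpa using hε
  · apply csq_im; rw [Complex.add_re, Complex.re_mul_ofReal]; simpa using hε

lemma arcosh_lim (s : ℝ) (hs : 0 < s) :
    Tendsto (fun N : ℝ => Real.arcosh (N / (2 * s)) - Real.log N) atTop (𝓝 (-Real.log s)) := by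
  have h1 : Tendsto (fun N : ℝ => Real.log (1 / (2 * s) + √((1 / (2 * s)) ^ 2 - (N⁻¹) ^ 2))) atTop
      (𝓝 (Real.log (1 / (2 * s) + √((1 / (2 * s)) ^ 2 - 0 ^ 2)))) := by
    apply Tendsto.log
    · apply Tendsto.const_add
      exact (((tendsto_inv_atTop_zero).pow 2).const_sub _).sqrt
    · positivity
  have e : Real.log (1 / (2 * s) + √((1 / (2 * s)) ^ 2 - 0 ^ 2)) = -Real.log s := by
    rw [zero_pow two_ne_zero, sub_zero, Real.sqrt_sq (by positivity), ← Real.log_inv]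
    congr 1; field_simp; norm_num
  rw [e] at h1
  refine h1.congr' ?_
  filter_upwards [eventually_gt_atTop (2 * s)] with N hN
  have hN0 : 0 < N := by linarith
  have h2 : √((N / (2 * s)) ^ 2 - 1) = N * √((1 / (2 * s)) ^ 2 - (N⁻¹) ^ 2) := by
    have : (N / (2 * s)) ^ 2 - 1 = N ^ 2 * ((1 / (2 * s)) ^ 2 - (N⁻¹) ^ 2) := by field_simp
    rw [this, Real.sqrt_mul (sq_nonneg N), Real.sqrt_sq hN0.le]
  have h3 : N / (2 * s) + √((N / (2 * s)) ^ 2 - 1)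
      = N * (1 / (2 * s) + √((1 / (2 * s)) ^ 2 - (N⁻¹) ^ 2)) := by
    rw [h2]; ring
  rw [Real.arcosh, h3, Real.log_mul hN0.ne' (by positivity)]
  ring

/-- Let `α ≠ 0` and `k ∈ ℝ²`, `k ≠ 0`, `s := |k|`. With
`J_N(s) := lim_{ε→0⁺} ∫_{‖ζ‖≤N} (‖ζ‖² + 2 s ζ₁ − iε)⁻¹ dζ` (which exists for `N > 2s`)
and `ε(N) := α/(1 − (α/2π) ln N)`, one has
`lim_{N→∞} ε(N)/(1 + ε(N)·(2π)⁻²·J_N(s)) = α/(1 + (α/4π)(πi − 2 ln|k|))`;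
moreover the limit denominator `1 + (α/4π)(πi − 2 ln|k|)` is nonzero. -/
theorem point_potential_scattering_coefficient_limit
    (α : ℝ) (hα : α ≠ 0) (k : EuclideanSpace ℝ (Fin 2)) (hk : k ≠ 0) :
    ∃ J : ℝ → ℂ,
      (∀ N : ℝ, 2 * ‖k‖ < N →
        Tendsto
          (fun ε : ℝ =>
            ∫ ζ in Metric.closedBall (0 : EuclideanSpace ℝ (Fin 2)) N,
              (((‖ζ‖ ^ 2 + 2 * ‖k‖ * ζ 0 : ℝ) : ℂ) - Complex.I * (ε : ℂ))⁻¹)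
          (𝓝[>] 0) (𝓝 (J N))) ∧
      Tendsto
        (fun N : ℝ =>
          ((α / (1 - α / (2 * Real.pi) * Real.log N) : ℝ) : ℂ) /
            (1 + ((α / (1 - α / (2 * Real.pi) * Real.log N) : ℝ) : ℂ)
                * (((2 * Real.pi : ℝ) : ℂ) ^ 2)⁻¹ * J N))
        atTop
        (𝓝 ((α : ℂ) / (1 + ((α : ℂ) / (4 * (Real.pi : ℂ)))
            * ((Real.pi : ℂ) * Complex.I - 2 * (Real.log ‖k‖ : ℂ))))) ∧
      (1 + ((α : ℂ) / (4 * (Real.pi : ℂ)))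
          * ((Real.pi : ℂ) * Complex.I - 2 * (Real.log ‖k‖ : ℂ)) ≠ 0) := by
  have hs : 0 < ‖k‖ := norm_pos_iff.mpr hk
  have hπ : (π : ℂ) ≠ 0 := by exact_mod_cast Real.pi_ne_zero
  have hαC : (α : ℂ) ≠ 0 := by exact_mod_cast hα
  have hD : (1 + ((α : ℂ) / (4 * (Real.pi : ℂ)))
          * ((Real.pi : ℂ) * Complex.I - 2 * (Real.log ‖k‖ : ℂ)) ≠ 0) := by
    intro h
    have e : (1 + ((α : ℂ) / (4 * (Real.pi : ℂ)))
          * ((Real.pi : ℂ) * Complex.I - 2 * (Real.log ‖k‖ : ℂ)))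
        = ((1 - α / (2 * π) * Real.log ‖k‖ : ℝ) : ℂ) + ((α / 4 : ℝ) : ℂ) * Complex.I := by
      push_cast; field_simp; ring
    rw [e] at h
    have := congrArg Complex.im h
    rw [Complex.add_im, Complex.ofReal_im, Complex.im_ofReal_mul, Complex.I_im, Complex.zero_im] at this
    apply hα; linarith
  refine ⟨fun N => 2 * π * Real.arcosh (N / (2 * ‖k‖)) + Complex.I * π ^ 2, ?_, ?_, hD⟩
  · intro N hN
    refine (rad_tendsto (2 * ‖k‖) N (by positivity) hN).congr' ?_
    filter_upwards [self_mem_nhdsWithin] with ε hε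
    exact (polar_eq ‖k‖ N ε hs (by linarith) hε).symm
  · have hl : Tendsto (fun N : ℝ => ((Real.arcosh (N / (2 * ‖k‖)) - Real.log N : ℝ) : ℂ)) atTop
        (𝓝 ((-Real.log ‖k‖ : ℝ) : ℂ)) :=
      (Complex.continuous_ofReal.tendsto _).comp (arcosh_lim ‖k‖ hs)
    have hl2 := (((hl.const_mul (1 / (2 * π : ℂ))).const_add ((1 : ℂ) / α + Complex.I / 4))).inv₀ (by
      intro h
      apply hD
      have : (α : ℂ) * (1 / (α : ℂ) + Complex.I / 4 + 1 / (2 * π : ℂ) * ((-Real.log ‖k‖ : ℝ) : ℂ)) = 0 := by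
        rw [h, mul_zero]
      rw [← this]; push_cast; field_simp; ring)
    have e : ((1 : ℂ) / α + Complex.I / 4 + 1 / (2 * π : ℂ) * ((-Real.log ‖k‖ : ℝ) : ℂ))⁻¹
        = (α : ℂ) / (1 + ((α : ℂ) / (4 * (Real.pi : ℂ)))
            * ((Real.pi : ℂ) * Complex.I - 2 * (Real.log ‖k‖ : ℂ))) := by
      rw [← one_div, eq_comm, ← mul_div_mul_left (1 : ℂ) _ hαC, mul_one]
      congr 1
      push_cast; field_simp; ring
    rw [e] at hl2
    refine hl2.congr' ?_
    filter_upwards [Real.tendsto_log_atTop.eventually_gt_atTop (2 * π / α)] with N hN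
    have hne : 1 - α / (2 * π) * Real.log N ≠ 0 := by
      intro h
      apply hN.ne
      have hp := Real.pi_ne_zero
      field_simp at h ⊢
      linarith
    have hneC : (1 - (α : ℂ) / (2 * π) * (Real.log N : ℂ)) ≠ 0 := by exact_mod_cast hne
    have hEC : (α : ℂ) / (1 - (α : ℂ) / (2 * π) * (Real.log N : ℂ)) ≠ 0 := div_ne_zero hαC hneC
    push_cast
    rw [← one_div, ← mul_div_mul_left (1 : ℂ) _ hEC, mul_one]
    congr 1
    generalize (Real.log N : ℂ) = L at *
    generalize (Real.arcosh (N / (2 * ‖k‖)) : ℂ) = A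
    have hinv : (α : ℂ) / (1 - (α : ℂ) / (2 * π) * L) * (1 / (α : ℂ) - L / (2 * π)) = 1 := by
      rw [div_mul_eq_mul_div, div_eq_one_iff_eq hneC]; field_simp
    generalize (α : ℂ) / (1 - (α : ℂ) / (2 * π) * L) = E at *
    have : E * (1 / (α : ℂ) + Complex.I / 4 + 1 / (2 * π) * (A - L))
        = E * (1 / (α : ℂ) - L / (2 * π)) + E * (Complex.I / 4 + A / (2 * π)) := by ring
    rw [this, hinv]
    congr 1
    field_simp
    ring
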